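/- (Perturbed linear regression for the IPMSM.) Let α > 0 and R, L_q, L_0, ψ_m ∈ ℝ with ψ_m > 0; set ℓ := ψ_m·L_0. Let θ : [0,∞) → ℝ, and let i, v : [0,∞) → ℝ² be bounded continuous signals with sup_{t≥0} |L_0|·‖i(t)‖ < ψ_m. Define λ := L_q·i + (L_0·(iᵀc(θ)) + ψ_m)·c(θ) and the active flux x := λ − L_q·i, and assume λ is differentiable with λ̇(t) = −R·i(t) + v(t) for all t ≥ 0. Define (componentwise, using the filters F, G, H): Ω₁ := F[v − R·i] − L_q·G[i], Ω₂ := Ω₁ − L_0·G[i], Φ := Ω₁ + Ω₂, y := L_0·(F[i]ᵀΩ₁) + (1/α)·‖Ω₁‖² + H[Ω₂ᵀΩ₁], and d := −ℓ·G[ iᵀ(x/‖x‖) ] (well defined since ‖x(t)‖ ≥ ψ_m − sup_{t≥0}|L_0|·‖i(t)‖ > 0). Then there exists a constant C ≥ 0 such that |y(t) − Φ(t)ᵀx(t) − d(t)| ≤ C·e^{−αt} for all t ≥ 0. -/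

import Mathlib

open scoped RealInnerProductSpace

/-- Scalar filter `F[u](t) = α ∫₀ᵗ e^{−α(t−s)} u(s) ds` (realization of `α/(p+α)`). -/
noncomputable def Ffilt (α : ℝ) (u : ℝ → ℝ) (t : ℝ) : ℝ :=
  α * ∫ s in (0 : ℝ)..t, Real.exp (-(α * (t - s))) * u s

/-- Scalar filter `H[u](t) = ∫₀ᵗ e^{−α(t−s)} u(s) ds` (realization of `1/(p+α)`). -/
noncomputable def Hfilt (α : ℝ) (u : ℝ → ℝ) (t : ℝ) : ℝ :=
  ∫ s in (0 : ℝ)..t, Real.exp (-(α * (t - s))) * u s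

/-- Scalar filter `G[u] = α(u − F[u])` (realization of `αp/(p+α)`). -/
noncomputable def Gfilt (α : ℝ) (u : ℝ → ℝ) (t : ℝ) : ℝ :=
  α * (u t - Ffilt α u t)

/-- Componentwise application of `F` to an `ℝ²`-valued signal. -/
noncomputable def FfiltV (α : ℝ) (u : ℝ → EuclideanSpace ℝ (Fin 2)) (t : ℝ) :
    EuclideanSpace ℝ (Fin 2) :=
  (WithLp.equiv 2 (Fin 2 → ℝ)).symm fun j => Ffilt α (fun s => u s j) t

/-- Componentwise application of `G` to an `ℝ²`-valued signal. -/
noncomputable def GfiltV (α : ℝ) (u : ℝ → EuclideanSpace ℝ (Fin 2)) (t : ℝ) :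
    EuclideanSpace ℝ (Fin 2) :=
  (WithLp.equiv 2 (Fin 2 → ℝ)).symm fun j => Gfilt α (fun s => u s j) t

/-- The unit vector at angle `θ` in the Euclidean plane: `c(θ) = (cos θ, sin θ)ᵀ`. -/
noncomputable def cE (θ : ℝ) : EuclideanSpace ℝ (Fin 2) :=
  (WithLp.equiv 2 (Fin 2 → ℝ)).symm ![Real.cos θ, Real.sin θ]

open Set

theorem Ffilt_eq_mul_Hfilt (α : ℝ) (u : ℝ → ℝ) (t : ℝ) : Ffilt α u t = α * Hfilt α u t := rfl

theorem Hfilt_zero_right (α : ℝ) (u : ℝ → ℝ) : Hfilt α u 0 = 0 := by simp [Hfilt]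

theorem Hfilt_congr {α : ℝ} {u w : ℝ → ℝ} (h : ∀ s, 0 ≤ s → u s = w s) {t : ℝ} (ht : 0 ≤ t) :
    Hfilt α u t = Hfilt α w t := by
  refine intervalIntegral.integral_congr fun s hs => ?_
  rw [uIcc_of_le ht] at hs
  simp only [h s hs.1]

theorem Hfilt_eq_exp_mul (α : ℝ) (u : ℝ → ℝ) (t : ℝ) :
    Hfilt α u t = Real.exp (-(α * t)) * ∫ s in (0 : ℝ)..t, Real.exp (α * s) * u s := by
  rw [Hfilt, ← intervalIntegral.integral_const_mul]
  refine intervalIntegral.integral_congr fun s _ => ?_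
  rw [← mul_assoc, ← Real.exp_add]
  ring_nf

theorem continuousOn_exp_mul {α : ℝ} {u : ℝ → ℝ} (hu : ContinuousOn u (Ici 0)) :
    ContinuousOn (fun s => Real.exp (α * s) * u s) (Ici 0) :=
  ContinuousOn.mul (by fun_prop) hu

theorem intervalIntegrable_of_continuousOn_Ici {u : ℝ → ℝ} (hu : ContinuousOn u (Ici 0))
    {t : ℝ} (ht : 0 ≤ t) : IntervalIntegrable u MeasureTheory.volume 0 t := by
  refine ContinuousOn.intervalIntegrable (hu.mono ?_)
  rw [uIcc_of_le ht]
  exact Icc_subset_Ici_self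

theorem Hfilt_linear {α : ℝ} {u w : ℝ → ℝ} (hu : ContinuousOn u (Ici 0))
    (hw : ContinuousOn w (Ici 0)) (a b : ℝ) {t : ℝ} (ht : 0 ≤ t) :
    Hfilt α (fun s => a * u s + b * w s) t = a * Hfilt α u t + b * Hfilt α w t := by
  have hu' := intervalIntegrable_of_continuousOn_Ici (continuousOn_exp_mul (α := α) hu) ht
  have hw' := intervalIntegrable_of_continuousOn_Ici (continuousOn_exp_mul (α := α) hw) ht
  have h : ∫ s in (0 : ℝ)..t, Real.exp (α * s) * (a * u s + b * w s) =
      a * (∫ s in (0 : ℝ)..t, Real.exp (α * s) * u s) +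
        b * ∫ s in (0 : ℝ)..t, Real.exp (α * s) * w s := by
    rw [← intervalIntegral.integral_const_mul, ← intervalIntegral.integral_const_mul,
      ← intervalIntegral.integral_add (hu'.const_mul a) (hw'.const_mul b)]
    refine intervalIntegral.integral_congr fun s _ => ?_
    ring
  simp only [Hfilt_eq_exp_mul, h]
  ring

theorem Gfilt_linear {α : ℝ} {u w : ℝ → ℝ} (hu : ContinuousOn u (Ici 0))
    (hw : ContinuousOn w (Ici 0)) (a b : ℝ) {t : ℝ} (ht : 0 ≤ t) :
    Gfilt α (fun s => a * u s + b * w s) t = a * Gfilt α u t + b * Gfilt α w t := by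
  simp only [Gfilt, Ffilt_eq_mul_Hfilt, Hfilt_linear hu hw a b ht]
  ring

theorem Gfilt_const_mul (α a : ℝ) (u : ℝ → ℝ) (t : ℝ) :
    Gfilt α (fun s => a * u s) t = a * Gfilt α u t := by
  simp only [Gfilt, Ffilt, mul_left_comm _ a, intervalIntegral.integral_const_mul]
  ring

theorem Gfilt_congr {α : ℝ} {u w : ℝ → ℝ} (h : ∀ s, 0 ≤ s → u s = w s) {t : ℝ} (ht : 0 ≤ t) :
    Gfilt α u t = Gfilt α w t := by
  simp only [Gfilt, Ffilt_eq_mul_Hfilt, Hfilt_congr h ht, h t ht]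

theorem continuousOn_Hfilt {α : ℝ} {u : ℝ → ℝ} (hu : ContinuousOn u (Ici 0)) :
    ContinuousOn (Hfilt α u) (Ici 0) := by
  have hc := continuousOn_exp_mul (α := α) hu
  have h : ContinuousOn (fun t => ∫ s in (0 : ℝ)..t, Real.exp (α * s) * u s) (Ici 0) := by
    intro t ht
    have ht' : (0 : ℝ) ≤ t + 1 := by linarith [mem_Ici.1 ht]
    have h1 := intervalIntegral.continuousOn_primitive_interval
      (intervalIntegrable_iff_integrableOn_Icc_of_le ht' |>.1
        (intervalIntegrable_of_continuousOn_Ici hc ht') |> fun h => by rwa [uIcc_of_le ht'])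
    rw [uIcc_of_le ht'] at h1
    refine (h1 t ⟨ht, by linarith⟩).mono_of_mem_nhdsWithin ?_
    rw [mem_nhdsWithin]
    exact ⟨Iio (t + 1), isOpen_Iio, by simp, fun s hs => ⟨hs.2, hs.1.le⟩⟩
  have h2 : Hfilt α u = fun t =>
      Real.exp (-(α * t)) * ∫ s in (0 : ℝ)..t, Real.exp (α * s) * u s :=
    funext fun t => Hfilt_eq_exp_mul α u t
  rw [h2]
  exact ContinuousOn.mul (by fun_prop) h

theorem hasDerivAt_exp_neg_mul (α t : ℝ) :
    HasDerivAt (fun t => Real.exp (-(α * t))) (-α * Real.exp (-(α * t))) t := by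
  have h : HasDerivAt (fun t : ℝ => -(α * t)) (-(α * 1)) t := ((hasDerivAt_id t).const_mul α).neg
  convert h.exp using 1
  ring

theorem hasDerivAt_Hfilt {α : ℝ} {u : ℝ → ℝ} (hu : ContinuousOn u (Ici 0)) {t : ℝ} (ht : 0 < t) :
    HasDerivAt (Hfilt α u) (u t - α * Hfilt α u t) t := by
  have hc := continuousOn_exp_mul (α := α) hu
  have h : HasDerivAt (fun t => ∫ s in (0 : ℝ)..t, Real.exp (α * s) * u s)
      (Real.exp (α * t) * u t) t := by
    refine intervalIntegral.integral_hasDerivAt_right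
      (intervalIntegrable_of_continuousOn_Ici hc ht.le) ?_ (hc.continuousAt (Ici_mem_nhds ht))
    exact (hc.mono Ioi_subset_Ici_self).stronglyMeasurableAtFilter isOpen_Ioi t ht
  have h2 : Hfilt α u = fun t =>
      Real.exp (-(α * t)) * ∫ s in (0 : ℝ)..t, Real.exp (α * s) * u s :=
    funext fun t => Hfilt_eq_exp_mul α u t
  rw [h2]
  refine ((hasDerivAt_exp_neg_mul α t).mul h).congr_deriv ?_
  rw [← mul_assoc (Real.exp (-(α * t))), ← Real.exp_add]
  simp
  ring

/-- Variation of constants: `H` inverts `p + α` up to the initial condition. -/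
theorem Hfilt_deriv_add {α : ℝ} {P P' f : ℝ → ℝ} (hP : ContinuousOn P (Ici 0))
    (hd : ∀ s, 0 < s → HasDerivAt P (P' s) s) (hf : ContinuousOn f (Ici 0))
    (h : ∀ s, 0 < s → f s = P' s + α * P s) {t : ℝ} (ht : 0 ≤ t) :
    Hfilt α f t = P t - Real.exp (-(α * t)) * P 0 := by
  have key : ∫ s in (0 : ℝ)..t, Real.exp (α * s) * f s =
      Real.exp (α * t) * P t - Real.exp (α * 0) * P 0 := by
    refine intervalIntegral.integral_eq_sub_of_hasDerivAt_of_le ht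
      ((continuousOn_exp_mul hP).mono Icc_subset_Ici_self) (fun s hs => ?_)
      (intervalIntegrable_of_continuousOn_Ici (continuousOn_exp_mul hf) ht)
    have he : HasDerivAt (fun t => Real.exp (α * t)) (α * Real.exp (α * s)) s := by
      simpa using hasDerivAt_exp_neg_mul (-α) s
    refine (he.mul (hd s hs.1)).congr_deriv ?_
    rw [h s hs.1]
    ring
  rw [Hfilt_eq_exp_mul, key, mul_sub, ← mul_assoc, ← Real.exp_add]
  simp

theorem Gfilt_const {α : ℝ} (hα : α ≠ 0) (c : ℝ) {t : ℝ} (ht : 0 ≤ t) :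
    Gfilt α (fun _ => c) t = α * c * Real.exp (-(α * t)) := by
  have h := Hfilt_deriv_add (α := α) (P := fun _ => c / α) (P' := fun _ => 0) (f := fun _ => c)
    continuousOn_const (fun s _ => hasDerivAt_const s _) continuousOn_const
    (fun s _ => by field_simp; simp) ht
  rw [Gfilt, Ffilt_eq_mul_Hfilt, h]
  field_simp
  ring

theorem Ffilt_deriv {α : ℝ} {P P' : ℝ → ℝ} (hP : ContinuousOn P (Ici 0))
    (hd : ∀ s, 0 < s → HasDerivAt P (P' s) s) (hP' : ContinuousOn P' (Ici 0))
    {t : ℝ} (ht : 0 ≤ t) :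
    Ffilt α P' t = Gfilt α P t - α * P 0 * Real.exp (-(α * t)) := by
  have h := Hfilt_deriv_add (α := α) (f := fun s => 1 * P' s + α * P s) hP hd
    (by fun_prop) (fun s _ => by ring) ht
  rw [Hfilt_linear hP' hP 1 α ht] at h
  simp only [Gfilt, Ffilt_eq_mul_Hfilt]
  linear_combination α * h

/-- Scalar swapping identity behind the regression; `k` collects the initial condition. -/
theorem filter_swapping {α : ℝ} (hα : α ≠ 0) {x z : ℝ → ℝ} (hx : ContinuousOn x (Ici 0))
    (hz : ContinuousOn z (Ici 0)) (k : ℝ) {t : ℝ} (ht : 0 ≤ t) :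
    Hfilt α (fun s => (Gfilt α z s + k * Real.exp (-(α * s))) *
        (Gfilt α x s + k * Real.exp (-(α * s)))) t =
      (Gfilt α x t + Gfilt α z t + 2 * (k * Real.exp (-(α * t)))) * x t
      - Gfilt α (fun s => x s * z s) t
      - (Ffilt α x t - Ffilt α z t) * (Gfilt α x t + k * Real.exp (-(α * t)))
      - 1 / α * (Gfilt α x t + k * Real.exp (-(α * t))) ^ 2
      + k ^ 2 / α * Real.exp (-(α * t)) := by
  have hxz : ContinuousOn (fun s => x s * z s) (Ici 0) := hx.mul hz
  have cX := continuousOn_Hfilt (α := α) hx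
  have cZ := continuousOn_Hfilt (α := α) hz
  have cXZ := continuousOn_Hfilt (α := α) hxz
  have h := Hfilt_deriv_add (α := α)
    (P := fun s => α ^ 2 * Hfilt α (fun s => x s * z s) s
      - α ^ 3 * (Hfilt α z s * Hfilt α x s)
      + k * α * (Real.exp (-(α * s)) * (Hfilt α x s + Hfilt α z s))
      - k ^ 2 / α * (Real.exp (-(α * s)) * Real.exp (-(α * s))))
    (f := fun s => (Gfilt α z s + k * Real.exp (-(α * s))) *
        (Gfilt α x s + k * Real.exp (-(α * s))))
    (by fun_prop)
    (fun s hs => (((((hasDerivAt_Hfilt hxz hs).const_mul (α ^ 2)).sub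
      (((hasDerivAt_Hfilt hz hs).mul (hasDerivAt_Hfilt hx hs)).const_mul (α ^ 3))).add
      (((hasDerivAt_exp_neg_mul α s).mul
        ((hasDerivAt_Hfilt hx hs).add (hasDerivAt_Hfilt hz hs))).const_mul (k * α))).sub
      (((hasDerivAt_exp_neg_mul α s).mul (hasDerivAt_exp_neg_mul α s)).const_mul (k ^ 2 / α))))
    (by simp only [Gfilt, Ffilt_eq_mul_Hfilt]; fun_prop)
    (fun s _ => by
      simp only [Gfilt, Ffilt_eq_mul_Hfilt, Pi.add_apply]
      field_simp
      ring) ht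
  rw [h]
  simp only [Gfilt, Ffilt_eq_mul_Hfilt, Hfilt_zero_right]
  simp only [mul_zero, neg_zero, Real.exp_zero]
  field_simp
  ring

theorem norm_cE (θ : ℝ) : ‖cE θ‖ = 1 := by
  simp [cE, EuclideanSpace.norm_eq, Fin.sum_univ_two]

/-- The algebraic constraint satisfied by the active flux `x = ρ c`, `ρ = L₀ iᵀc + ψ > 0`. -/
theorem active_flux_constraint {E : Type*} [NormedAddCommGroup E] [InnerProductSpace ℝ E]
    {L ψ : ℝ} {i c x : E} (hc : ‖c‖ = 1) (hi : |L| * ‖i‖ < ψ)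
    (hx : x = (L * ⟪i, c⟫ + ψ) • c) :
    ⟪x, x - L • i⟫ = ψ ^ 2 + ψ * L * ⟪i, ‖x‖⁻¹ • x⟫ := by
  have h1 : |L * ⟪i, c⟫| ≤ |L| * ‖i‖ := by
    rw [abs_mul]
    gcongr
    simpa [hc] using abs_real_inner_le_norm i c
  have hρ : 0 < L * ⟪i, c⟫ + ψ := by linarith [neg_abs_le (L * ⟪i, c⟫)]
  have hn : ‖x‖ = L * ⟪i, c⟫ + ψ := by
    rw [hx, norm_smul, hc, mul_one, Real.norm_eq_abs, abs_of_pos hρ]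
  have hu : ‖x‖⁻¹ • x = c := by
    rw [hn, hx, smul_smul, inv_mul_cancel₀ hρ.ne', one_smul]
  rw [hu, inner_sub_right, real_inner_self_eq_norm_sq, hn, inner_smul_right, hx, inner_smul_left,
    real_inner_comm]
  simp
  ring

/-- perturbed linear regression for the IPMSM: with the filtered signals
`Ω₁, Ω₂, Φ, y` and the disturbance `d` built from the bounded continuous signals `i, v`,
the active flux `x = λ − L_q i` of the motor `λ̇ = −R i + v`,
`λ = L_q i + (L_0 iᵀc(θ) + ψ_m) c(θ)` satisfies `|y − Φᵀx − d| ≤ C e^{−αt}` on `[0,∞)`. -/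
theorem stmt5 (α R Lq L0 ψm ℓ : ℝ) (hα : 0 < α) (hψ : 0 < ψm) (hℓ : ℓ = ψm * L0)
    (θ : ℝ → ℝ) (i v : ℝ → EuclideanSpace ℝ (Fin 2))
    (hic : ContinuousOn i (Set.Ici 0)) (hvc : ContinuousOn v (Set.Ici 0))
    (Bv : ℝ) (hBv : ∀ t, 0 ≤ t → ‖v t‖ ≤ Bv)
    (b : ℝ) (hb : b < ψm) (hib : ∀ t, 0 ≤ t → |L0| * ‖i t‖ ≤ b)
    (lam x : ℝ → EuclideanSpace ℝ (Fin 2))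
    (hlam : ∀ t, lam t = Lq • i t + (L0 * ⟪i t, cE (θ t)⟫ + ψm) • cE (θ t))
    (hx : ∀ t, x t = lam t - Lq • i t)
    (hfar : ∀ t, 0 ≤ t → HasDerivAt lam (-(R • i t) + v t) t)
    (Ω₁ Ω₂ Φ : ℝ → EuclideanSpace ℝ (Fin 2)) (y d : ℝ → ℝ)
    (hΩ₁ : ∀ t, Ω₁ t = FfiltV α (fun s => v s - R • i s) t - Lq • GfiltV α i t)
    (hΩ₂ : ∀ t, Ω₂ t = Ω₁ t - L0 • GfiltV α i t)
    (hΦ : ∀ t, Φ t = Ω₁ t + Ω₂ t)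
    (hy : ∀ t, y t = L0 * ⟪FfiltV α i t, Ω₁ t⟫ + (1 / α) * ‖Ω₁ t‖ ^ 2
        + Hfilt α (fun s => ⟪Ω₂ s, Ω₁ s⟫) t)
    (hd : ∀ t, d t = -(ℓ * Gfilt α (fun s => ⟪i s, ‖x s‖⁻¹ • x s⟫) t)) :
    ∃ C, 0 ≤ C ∧ ∀ t, 0 ≤ t → |y t - ⟪Φ t, x t⟫ - d t| ≤ C * Real.exp (-(α * t)) := by
  have hα' := hα.ne'
  have clam : ContinuousOn lam (Ici 0) := fun t ht => (hfar t ht).continuousAt.continuousWithinAt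
  have ci (j : Fin 2) : ContinuousOn (fun s => i s j) (Ici 0) := by fun_prop
  have cv (j : Fin 2) : ContinuousOn (fun s => v s j) (Ici 0) := by fun_prop
  have cl (j : Fin 2) : ContinuousOn (fun s => lam s j) (Ici 0) := by fun_prop
  have xj (j : Fin 2) (s : ℝ) : x s j = 1 * lam s j + (-Lq) * i s j := by
    rw [hx]; simp; ring
  have cx (j : Fin 2) : ContinuousOn (fun s => x s j) (Ici 0) := by
    simp only [xj]; fun_prop
  let z : Fin 2 → ℝ → ℝ := fun j s => 1 * x s j + (-L0) * i s j
  have cz (j : Fin 2) : ContinuousOn (z j) (Ici 0) := by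
    have := cx j; have := ci j; simp only [z]; fun_prop
  let k : Fin 2 → ℝ := fun j => -(α * lam 0 j)
  have hΩ₁j (j : Fin 2) {t : ℝ} (ht : 0 ≤ t) :
      Ω₁ t j = Gfilt α (fun s => x s j) t + k j * Real.exp (-(α * t)) := by
    have hd (s : ℝ) (hs : 0 < s) :
        HasDerivAt (fun s => lam s j) ((v s - R • i s) j) s := by
      have h := (EuclideanSpace.proj (𝕜 := ℝ) j).hasFDerivAt.comp_hasDerivAt s (hfar s hs.le)
      refine h.congr_deriv ?_
      simp; ring
    have hF := Ffilt_deriv (α := α) (cl j) hd (by fun_prop) ht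
    have hG : Gfilt α (fun s => x s j) t =
        1 * Gfilt α (fun s => lam s j) t + (-Lq) * Gfilt α (fun s => i s j) t := by
      simp only [xj]
      exact Gfilt_linear (cl j) (ci j) 1 (-Lq) ht
    have : Ω₁ t j = Ffilt α (fun s => (v s - R • i s) j) t - Lq * Gfilt α (fun s => i s j) t := by
      rw [hΩ₁]; simp [FfiltV, GfiltV]
    rw [this, hF, hG]
    simp only [k]; ring
  have hGz (j : Fin 2) {t : ℝ} (ht : 0 ≤ t) :
      Gfilt α (z j) t = 1 * Gfilt α (fun s => x s j) t + (-L0) * Gfilt α (fun s => i s j) t :=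
    Gfilt_linear (cx j) (ci j) 1 (-L0) ht
  have hΩ₂j (j : Fin 2) {t : ℝ} (ht : 0 ≤ t) :
      Ω₂ t j = Gfilt α (z j) t + k j * Real.exp (-(α * t)) := by
    have : Ω₂ t j = Ω₁ t j - L0 * Gfilt α (fun s => i s j) t := by
      rw [hΩ₂]; simp [GfiltV]
    rw [this, hΩ₁j j ht, hGz j ht]
    ring
  have hFi (j : Fin 2) {t : ℝ} (ht : 0 ≤ t) :
      L0 * Ffilt α (fun s => i s j) t = Ffilt α (fun s => x s j) t - Ffilt α (z j) t := by
    have := Hfilt_linear (α := α) (cx j) (ci j) 1 (-L0) ht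
    simp only [Ffilt_eq_mul_Hfilt, z, this]
    ring
  have cG {u : ℝ → ℝ} (hu : ContinuousOn u (Ici 0)) : ContinuousOn (Gfilt α u) (Ici 0) := by
    have := continuousOn_Hfilt (α := α) hu
    have h : Gfilt α u = fun t => α * (u t - α * Hfilt α u t) := rfl
    rw [h]; fun_prop
  have hH {t : ℝ} (ht : 0 ≤ t) : Hfilt α (fun s => ⟪Ω₂ s, Ω₁ s⟫) t =
      1 * Hfilt α (fun s => (Gfilt α (z 0) s + k 0 * Real.exp (-(α * s))) *
        (Gfilt α (fun s => x s 0) s + k 0 * Real.exp (-(α * s)))) t +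
      1 * Hfilt α (fun s => (Gfilt α (z 1) s + k 1 * Real.exp (-(α * s))) *
        (Gfilt α (fun s => x s 1) s + k 1 * Real.exp (-(α * s)))) t := by
    have := cG (cz 0)
    have := cG (cz 1)
    have := cG (cx 0)
    have := cG (cx 1)
    rw [← Hfilt_linear (by fun_prop) (by fun_prop) 1 1 ht]
    refine Hfilt_congr (fun s hs => ?_) ht
    simp only [PiLp.inner_apply, Fin.sum_univ_two, hΩ₁j _ hs, hΩ₂j _ hs, RCLike.inner_apply,
      conj_trivial]
    ring
  have hunit (s : ℝ) (hs : 0 ≤ s) :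
      1 * (x s 0 * z 0 s) + 1 * (x s 1 * z 1 s) + -(ψm ^ 2) * 1 =
        ℓ * ⟪i s, ‖x s‖⁻¹ • x s⟫ := by
    have h := active_flux_constraint (norm_cE (θ s)) ((hib s hs).trans_lt hb)
      (x := x s) (by rw [hx, hlam]; abel)
    rw [hℓ]
    rw [PiLp.inner_apply, Fin.sum_univ_two] at h
    simp only [RCLike.inner_apply, conj_trivial, PiLp.sub_apply, PiLp.smul_apply,
      smul_eq_mul] at h
    simp only [z]
    linear_combination h
  have hdist {t : ℝ} (ht : 0 ≤ t) : Gfilt α (fun s => x s 0 * z 0 s) t +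
      Gfilt α (fun s => x s 1 * z 1 s) t = α * ψm ^ 2 * Real.exp (-(α * t)) - d t := by
    have c0 : ContinuousOn (fun s => x s 0 * z 0 s) (Ici 0) := (cx 0).mul (cz 0)
    have c1 : ContinuousOn (fun s => x s 1 * z 1 s) (Ici 0) := (cx 1).mul (cz 1)
    have c01 : ContinuousOn (fun s => 1 * (x s 0 * z 0 s) + 1 * (x s 1 * z 1 s)) (Ici 0) := by
      fun_prop
    have hc := Gfilt_const hα' 1 ht
    have hsum := Gfilt_linear (α := α) c01 continuousOn_const 1 (-(ψm ^ 2)) (w := fun _ => 1) ht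
    rw [Gfilt_linear c0 c1 1 1 ht, hc, Gfilt_congr (w := fun s => ℓ * ⟪i s, ‖x s‖⁻¹ • x s⟫)
      (fun s hs => by rw [← hunit s hs]; ring) ht, Gfilt_const_mul] at hsum
    linear_combination -hsum + hd t
  refine ⟨|((k 0) ^ 2 + (k 1) ^ 2) / α - α * ψm ^ 2|, abs_nonneg _, fun t ht => ?_⟩
  rw [← abs_of_pos (Real.exp_pos (-(α * t))), ← abs_mul]
  refine le_of_eq (congrArg _ ?_)
  have h0 := filter_swapping hα' (cx 0) (cz 0) (k 0) ht
  have h1 := filter_swapping hα' (cx 1) (cz 1) (k 1) ht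
  have hin : L0 * ⟪FfiltV α i t, Ω₁ t⟫ = L0 * Ffilt α (fun s => i s 0) t * Ω₁ t 0 +
      L0 * Ffilt α (fun s => i s 1) t * Ω₁ t 1 := by
    simp only [FfiltV, PiLp.inner_apply, Fin.sum_univ_two, RCLike.inner_apply, conj_trivial,
      WithLp.equiv_symm_apply]
    ring
  have hΦx : ⟪Φ t, x t⟫ = (Ω₁ t 0 + Ω₂ t 0) * x t 0 + (Ω₁ t 1 + Ω₂ t 1) * x t 1 := by
    simp only [hΦ, PiLp.inner_apply, Fin.sum_univ_two, RCLike.inner_apply, conj_trivial,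
      PiLp.add_apply]
    ring
  rw [hy, hin, hΦx, EuclideanSpace.real_norm_sq_eq, Fin.sum_univ_two, hFi 0 ht, hFi 1 ht, hH ht,
    h0, h1, hΩ₁j 0 ht, hΩ₁j 1 ht, hΩ₂j 0 ht, hΩ₂j 1 ht]
  linear_combination -hdist ht
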